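/- There is a unique β₀ ∈ (0, 1] satisfying β₀·(M − m)·(max(0, 1 − 1/(β₀·T)))^T − (1 − β₀)·m = 0, and the competitive ratio of the one-way trading problem equals β₀; that is, sup over trading policies x of inf over price paths p of r^x(p)/r*(p) = β₀. -/

import Mathlib

open scoped BigOperators

namespace OneWayTrading

/-- The running state `(guarantee, amount sold)` of the threat-based policy: at each price `p`
sell just enough to lift the guaranteed revenue to `β * p`. -/
noncomputable def threatState (β m : ℝ) (l : List ℝ) : ℝ × ℝ :=
  l.foldl (fun s p => (max s.1 (β * p), s.2 + (max s.1 (β * p) - s.1) / (p - m))) (m, 0)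

lemma threatState_nil (β m : ℝ) : threatState β m [] = (m, 0) := rfl

lemma threatState_concat (β m : ℝ) (l : List ℝ) (p : ℝ) :
    threatState β m (l ++ [p]) =
      (max (threatState β m l).1 (β * p), (threatState β m l).2 +
        (max (threatState β m l).1 (β * p) - (threatState β m l).1) / (p - m)) := by
  simp [threatState, List.foldl_append]

lemma le_threatState_fst (β m : ℝ) (l : List ℝ) : m ≤ (threatState β m l).1 := by
  induction l using List.reverseRecOn with
  | nil => simp [threatState_nil]
  | append_singleton l p ih => rw [threatState_concat]; exact ih.trans (le_max_left _ _)

lemma mul_le_threatState_fst (β m : ℝ) (l : List ℝ) : ∀ p ∈ l, β * p ≤ (threatState β m l).1 := by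
  induction l using List.reverseRecOn with
  | nil => simp
  | append_singleton l q ih =>
    intro p hp
    rw [threatState_concat]
    rcases List.mem_append.1 hp with h | h
    · exact (ih p h).trans (le_max_left _ _)
    · rw [List.mem_singleton.1 h]; exact le_max_right _ _

lemma threatState_fst_le {β m B : ℝ} (hm : m ≤ B) {l : List ℝ} (h : ∀ p ∈ l, β * p ≤ B) :
    (threatState β m l).1 ≤ B := by
  induction l using List.reverseRecOn with
  | nil => simpa [threatState_nil]
  | append_singleton l q ih =>
    rw [threatState_concat]
    exact max_le (ih fun p hp => h p (by simp [hp])) (h q (by simp))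

lemma threatState_snd_le_concat {β m : ℝ} (l : List ℝ) {p : ℝ} (hp : m ≤ p) :
    (threatState β m l).2 ≤ (threatState β m (l ++ [p])).2 := by
  rw [threatState_concat]
  exact le_add_of_nonneg_right
    (div_nonneg (sub_nonneg.2 (le_max_left _ _)) (sub_nonneg.2 hp))

lemma sub_mul_threatState_snd {β m : ℝ} (hm : 0 ≤ m) (hβ : β ≤ 1) (l : List ℝ) (p : ℝ) :
    (p - m) * ((threatState β m (l ++ [p])).2 - (threatState β m l).2) =
      (threatState β m (l ++ [p])).1 - (threatState β m l).1 := by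
  rw [threatState_concat]
  have hg := le_threatState_fst β m l
  rcases eq_or_ne (p - m) 0 with h | h
  · have hp : p = m := sub_eq_zero.1 h
    have : β * p ≤ (threatState β m l).1 := by rw [hp]; nlinarith
    simp [max_eq_left this]
  · field_simp
    ring

/-- One step of the tangent-line form of the AM-GM inequality. -/
lemma one_sub_div_le {ρ z w : ℝ} (hρ : 0 < ρ) (hz : 0 < z) (hw : 0 < w) :
    1 - z / w ≤ (1 - ρ + ρ * Real.log ρ) + ρ * (Real.log w - Real.log z) := by
  have h := Real.log_le_sub_one_of_pos (show 0 < z / w / ρ by positivity)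
  rw [Real.log_div (by positivity) hρ.ne', Real.log_div hz.ne' hw.ne'] at h
  have h2 := mul_le_mul_of_nonneg_left h hρ.le
  have h3 : ρ * (z / w / ρ - 1) = z / w - ρ := by field_simp
  rw [h3] at h2
  linarith

lemma threatState_snd_le_log {β m ρ : ℝ} (hm : 0 < m) (hβ : 0 < β) (hβ1 : β < 1) (hρ : 0 < ρ)
    (l : List ℝ) :
    (threatState β m l).2 ≤ β * (l.length * (1 - ρ + ρ * Real.log ρ) +
      ρ * (Real.log ((threatState β m l).1 - β * m) - Real.log (m - β * m))) := by
  induction l using List.reverseRecOn with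
  | nil => simp [threatState_nil]
  | append_singleton l p ih =>
    rw [threatState_concat, List.length_append, List.length_singleton]
    push_cast
    set g := (threatState β m l).1 with hg
    have hmg : m ≤ g := le_threatState_fst β m l
    have hpos : 0 < g - β * m := by nlinarith
    have hw : 0 < max g (β * p) - β * m := hpos.trans_le (sub_le_sub_right (le_max_left _ _) _)
    have hstep : (max g (β * p) - g) / (p - m) ≤
        β * (1 - (g - β * m) / (max g (β * p) - β * m)) := by
      rcases le_total (β * p) g with h | h
      · rw [max_eq_left h, div_self hpos.ne']; simp
      · rw [max_eq_right h] at hw ⊢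
        have hp : 0 < p - m := by nlinarith
        have : β * p - β * m = β * (p - m) := by ring
        rw [this]
        apply le_of_eq
        field_simp
        ring
    have := mul_le_mul_of_nonneg_left (one_sub_div_le hρ hpos hw) hβ.le
    nlinarith

/-- The cumulative amount sold by the policy that follows `threatState` before period `T` and
sells the remainder in period `T`. -/
noncomputable def cumulativeSold (β m : ℝ) (T : ℕ) (l : List ℝ) : ℝ :=
  if l.length < T then (threatState β m l).2 else 1

/-- The threat-based policy. -/
noncomputable def threatPolicy (β m : ℝ) (T : ℕ) (l : List ℝ) : ℝ :=
  cumulativeSold β m T l - cumulativeSold β m T l.dropLast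

lemma take_succ_ofFn {T : ℕ} (p : Fin T → ℝ) {k : ℕ} (hk : k < T) :
    (List.ofFn p).take (k + 1) = (List.ofFn p).take k ++ [p ⟨k, hk⟩] := by
  rw [List.take_succ_eq_append_getElem (by simpa using hk)]
  simp

lemma dropLast_take_succ_ofFn {T : ℕ} (p : Fin T → ℝ) {k : ℕ} (hk : k < T) :
    ((List.ofFn p).take (k + 1)).dropLast = (List.ofFn p).take k := by
  rw [take_succ_ofFn p hk, List.dropLast_concat]

lemma threatPolicy_nonneg {β m M : ℝ} {T : ℕ}
    (hS : ∀ l : List ℝ, l.length ≤ T → (∀ y ∈ l, y ∈ Set.Icc m M) → (threatState β m l).2 ≤ 1)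
    {l : List ℝ} (hl : l.length ≤ T) (hy : ∀ y ∈ l, y ∈ Set.Icc m M) :
    0 ≤ threatPolicy β m T l := by
  rcases List.eq_nil_or_concat' l with rfl | ⟨l, p, rfl⟩
  · simp [threatPolicy]
  · have hlen : l.length < T := by simp at hl; omega
    rw [threatPolicy, List.dropLast_concat, cumulativeSold, cumulativeSold, if_pos hlen, sub_nonneg]
    split_ifs
    · exact threatState_snd_le_concat l (hy p (by simp)).1
    · exact hS l hlen.le fun y h => hy y (by simp [h])

lemma sum_threatPolicy (β m : ℝ) {T : ℕ} (hT : 1 ≤ T) (p : Fin T → ℝ) :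
    ∑ t : Fin T, threatPolicy β m T ((List.ofFn p).take (t.1 + 1)) = 1 := by
  have h : ∀ t : Fin T, threatPolicy β m T ((List.ofFn p).take (t.1 + 1)) =
      cumulativeSold β m T ((List.ofFn p).take (t.1 + 1)) -
        cumulativeSold β m T ((List.ofFn p).take t.1) := fun t => by
    rw [threatPolicy, dropLast_take_succ_ofFn p t.2]
  rw [Finset.sum_congr rfl fun t _ => h t, Fin.sum_univ_eq_sum_range (fun k =>
    cumulativeSold β m T ((List.ofFn p).take (k + 1)) -
      cumulativeSold β m T ((List.ofFn p).take k)) T, Finset.sum_range_sub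
        (fun k => cumulativeSold β m T ((List.ofFn p).take k))]
  simp [cumulativeSold, threatState_nil, show 0 < T by omega]

lemma le_revenue_threatPolicy {β m M : ℝ} (hm : 0 ≤ m) (hβ : β ≤ 1) {T : ℕ} (hT : 1 ≤ T)
    (hS : ∀ l : List ℝ, l.length ≤ T → (∀ y ∈ l, y ∈ Set.Icc m M) → (threatState β m l).2 ≤ 1)
    {p : Fin T → ℝ} (hp : ∀ t, p t ∈ Set.Icc m M) :
    (threatState β m (List.ofFn p)).1 ≤
      ∑ t : Fin T, p t * threatPolicy β m T ((List.ofFn p).take (t.1 + 1)) := by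
  have hstep : ∀ t : Fin T, (threatState β m ((List.ofFn p).take (t.1 + 1))).1 -
      (threatState β m ((List.ofFn p).take t.1)).1 ≤
        (p t - m) * threatPolicy β m T ((List.ofFn p).take (t.1 + 1)) := by
    intro t
    have hmem : ∀ y ∈ (List.ofFn p).take (t.1 + 1), y ∈ Set.Icc m M := by
      intro y hy
      obtain ⟨i, rfl⟩ := (List.mem_ofFn' _ _).1 (List.mem_of_mem_take hy)
      exact hp i
    have hle := hS _ (by simp) hmem
    rw [threatPolicy, dropLast_take_succ_ofFn p t.2]
    rw [take_succ_ofFn p t.2] at hle ⊢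
    rw [← sub_mul_threatState_snd hm hβ]
    refine mul_le_mul_of_nonneg_left ?_ (sub_nonneg.2 (hp t).1)
    rw [cumulativeSold, cumulativeSold, if_pos (by simp [t.2] : ((List.ofFn p).take t.1).length < T)]
    split_ifs
    · exact le_rfl
    · linarith
  have hsum := Finset.sum_le_sum fun t (_ : t ∈ Finset.univ) => hstep t
  rw [Fin.sum_univ_eq_sum_range (fun k => (threatState β m ((List.ofFn p).take (k + 1))).1 -
      (threatState β m ((List.ofFn p).take k)).1) T, Finset.sum_range_sub
        (fun k => (threatState β m ((List.ofFn p).take k)).1)] at hsum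
  have htot := sum_threatPolicy β m hT p
  simp only [sub_mul, Finset.sum_sub_distrib, ← Finset.mul_sum, htot] at hsum
  rw [List.take_of_length_le (by simp)] at hsum
  simp only [List.take_zero, threatState_nil] at hsum
  linarith

/-- A root of the equation is either `1` (and `T = 1`), or it is less than `1` and the ratio
`1 - 1 / (β * T)` of the extremal geometric price path is positive. -/
lemma root_cases {m M β : ℝ} (hm : 0 < m) (hmM : m < M) {T : ℕ} (hT : 1 ≤ T)
    (hβ : β ∈ Set.Ioc (0 : ℝ) 1)
    (h : β * (M - m) * (max 0 (1 - 1 / (β * T))) ^ T - (1 - β) * m = 0) :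
    (β = 1 ∧ T = 1) ∨ (β < 1 ∧ 0 < 1 - 1 / (β * T) ∧
      β * (M - m) * (1 - 1 / (β * T)) ^ T = (1 - β) * m) := by
  have hT0 : (0 : ℝ) < T := by exact_mod_cast hT
  rcases le_or_gt (1 - 1 / (β * T)) 0 with hρ | hρ
  · left
    rw [max_eq_left hρ, zero_pow (by omega)] at h
    have h1 : β = 1 := by
      have : (1 - β) * m = 0 := by linarith
      rcases mul_eq_zero.1 this with h' | h' <;> linarith
    refine ⟨h1, ?_⟩
    rw [h1, one_mul, sub_nonpos, le_div_iff₀ hT0, one_mul] at hρ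
    have : T ≤ 1 := by exact_mod_cast hρ
    omega
  · right
    rw [max_eq_right hρ.le] at h
    refine ⟨lt_of_le_of_ne hβ.2 ?_, hρ, by linarith⟩
    rintro rfl
    have : 0 < 1 * (M - m) * (1 - 1 / (1 * T)) ^ T :=
      mul_pos (by linarith) (pow_pos hρ _)
    linarith

lemma threatState_snd_le_one {m M β : ℝ} (hm : 0 < m) (hmM : m < M) {T : ℕ} (hT : 1 ≤ T)
    (hβ : β ∈ Set.Ioc (0 : ℝ) 1)
    (h : β * (M - m) * (max 0 (1 - 1 / (β * T))) ^ T - (1 - β) * m = 0)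
    {l : List ℝ} (hl : l.length ≤ T) (hy : ∀ y ∈ l, y ∈ Set.Icc m M) :
    (threatState β m l).2 ≤ 1 := by
  have hT0 : (0 : ℝ) < T := by exact_mod_cast hT
  have hβ0 := hβ.1
  rcases root_cases hm hmM hT hβ h with ⟨rfl, rfl⟩ | ⟨hβ1, hρ, heq⟩
  · rcases List.eq_nil_or_concat' l with rfl | ⟨l, p, rfl⟩
    · simp [threatState_nil]
    · obtain rfl : l = [] := by simpa using hl
      have hp := (hy p (by simp)).1
      rw [threatState_concat, threatState_nil, one_mul, max_eq_right hp, zero_add]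
      exact div_self_le_one _
  · set ρ := 1 - 1 / (β * T) with hρdef
    have hβT : β * T * (1 - ρ) = 1 := by rw [hρdef]; field_simp; ring
    have hlog := threatState_snd_le_log hm hβ0 hβ1 hρ l
    have hg : (threatState β m l).1 ≤ β * M := by
      refine threatState_fst_le ?_ fun p hp => mul_le_mul_of_nonneg_left (hy p hp).2 hβ0.le
      have : ρ ^ T ≤ 1 := pow_le_one₀ hρ.le (sub_le_self 1 (by positivity))
      have : β * (M - m) * ρ ^ T ≤ β * (M - m) * 1 :=
        mul_le_mul_of_nonneg_left this (mul_nonneg hβ0.le (by linarith))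
      linarith
    have hmg := le_threatState_fst β m l
    have hpos : 0 < (threatState β m l).1 - β * m := by nlinarith
    have h1 : Real.log ((threatState β m l).1 - β * m) ≤ Real.log (β * (M - m)) :=
      Real.log_le_log hpos (by linarith)
    have h2 : Real.log (m - β * m) = Real.log (β * (M - m)) + T * Real.log ρ := by
      rw [show m - β * m = β * (M - m) * ρ ^ T by linarith,
        Real.log_mul (mul_pos hβ0 (by linarith)).ne' (pow_pos hρ _).ne', Real.log_pow]
    have h3 : 0 ≤ 1 - ρ + ρ * Real.log ρ := by
      simpa using one_sub_div_le hρ one_pos one_pos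
    have h4 : (l.length : ℝ) * (1 - ρ + ρ * Real.log ρ) ≤ T * (1 - ρ + ρ * Real.log ρ) :=
      mul_le_mul_of_nonneg_right (by exact_mod_cast hl) h3
    calc (threatState β m l).2 ≤ _ := hlog
      _ ≤ β * (T * (1 - ρ + ρ * Real.log ρ) + ρ * (-(T * Real.log ρ))) := by
        gcongr
        linarith
      _ = β * T * (1 - ρ) := by ring
      _ = 1 := hβT

/-- Along a geometric sequence of excess prices `y`, guaranteeing a ratio `c > β` after every
period requires selling more than `β * (1 - ρ) * n`. -/
lemma lt_sum_of_guarantee {β c m ρ : ℝ} (hm : 0 < m) (hβc : β < c) {y x : ℕ → ℝ} {n : ℕ}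
    (hn : 1 ≤ n) (hy : ∀ k ≤ n, 0 < y k) (hmono : ∀ k < n, y k ≤ y (k + 1))
    (hgeom : ∀ k < n, y k = ρ * y (k + 1)) (hy0 : β * y 0 = (1 - β) * m)
    (hA : ∀ k, 1 ≤ k → k ≤ n → c * (m + y k) ≤ m + ∑ i ∈ Finset.range k, y (i + 1) * x i) :
    β * (1 - ρ) * n < ∑ i ∈ Finset.range n, x i := by
  have hD : ∀ k, 1 ≤ k → k ≤ n →
      0 < ∑ i ∈ Finset.range k, y (i + 1) * x i - β * (y k - y 0) := by
    intro k h1 hk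
    have := hA k h1 hk
    have := mul_lt_mul_of_pos_right hβc (add_pos hm (hy k hk))
    linarith
  have key : ∀ k ≤ n, (∑ i ∈ Finset.range k, y (i + 1) * x i - β * (y k - y 0)) / y k ≤
      ∑ i ∈ Finset.range k, x i - β * (1 - ρ) * k := by
    intro k
    induction k with
    | zero => simp
    | succ k ih =>
      intro hk
      have hk' : k ≤ n := by omega
      have hD0 : 0 ≤ ∑ i ∈ Finset.range k, y (i + 1) * x i - β * (y k - y 0) := by
        rcases Nat.eq_zero_or_pos k with rfl | h
        · simp
        · exact (hD k h hk').le
      have h1 := (div_le_div_of_nonneg_left hD0 (hy k hk') (hmono k hk)).trans (ih hk')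
      have hy1 := hy (k + 1) hk
      rw [Finset.sum_range_succ, Finset.sum_range_succ]
      push_cast
      have h2 : (∑ i ∈ Finset.range k, y (i + 1) * x i + y (k + 1) * x k -
          β * (y (k + 1) - y 0)) / y (k + 1) =
          (∑ i ∈ Finset.range k, y (i + 1) * x i - β * (y k - y 0)) / y (k + 1) + x k -
            β * (1 - ρ) := by
        rw [hgeom k hk]
        field_simp
        ring
      rw [h2]
      linarith
  have := (div_pos (hD n hn le_rfl) (hy n le_rfl)).trans_le (key n le_rfl)
  linarith

lemma revenue_ratio_nonneg {m M : ℝ} (hm : 0 < m) {T : ℕ} {σ : List ℝ → ℝ}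
    (hσ : ∀ l : List ℝ, l.length ≤ T → (∀ y ∈ l, y ∈ Set.Icc m M) → 0 ≤ σ l)
    {p : Fin T → ℝ} (hp : ∀ t, p t ∈ Set.Icc m M) :
    0 ≤ (∑ t : Fin T, p t * σ ((List.ofFn p).take (t.1 + 1))) / (⨆ t : Fin T, p t) := by
  have hp0 : ∀ t, 0 ≤ p t := fun t => hm.le.trans (hp t).1
  refine div_nonneg (Finset.sum_nonneg fun t _ => mul_nonneg (hp0 t) (hσ _ (by simp) ?_))
    (Real.iSup_nonneg hp0)
  intro y hy
  obtain ⟨i, rfl⟩ := (List.mem_ofFn' _ _).1 (List.mem_of_mem_take hy)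
  exact hp i

lemma take_ofFn_congr {T : ℕ} {p q : Fin T → ℝ} {k : ℕ} (h : ∀ t : Fin T, t.1 < k → p t = q t) :
    (List.ofFn p).take k = (List.ofFn q).take k := by
  refine List.ext_getElem (by simp) fun i h1 _ => ?_
  simp only [List.length_take, List.length_ofFn, lt_min_iff] at h1
  simpa using h ⟨i, h1.2⟩ h1.1

/-- No policy guarantees a competitive ratio above the root `β`. -/
lemma guarantee_le {m M β c : ℝ} (hm : 0 < m) (hmM : m < M) {T : ℕ} (hT : 1 ≤ T)
    (hβ : β ∈ Set.Ioc (0 : ℝ) 1)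
    (h : β * (M - m) * (max 0 (1 - 1 / (β * T))) ^ T - (1 - β) * m = 0) {σ : List ℝ → ℝ}
    (hσ : ∀ p : Fin T → ℝ, (∀ t, p t ∈ Set.Icc m M) →
      ∑ t : Fin T, σ ((List.ofFn p).take (t.1 + 1)) = 1)
    (hc : ∀ p : Fin T → ℝ, (∀ t, p t ∈ Set.Icc m M) → ∀ s, c * p s ≤
      ∑ t : Fin T, p t * σ ((List.ofFn p).take (t.1 + 1))) :
    c ≤ β := by
  have hT0 : (0 : ℝ) < T := by exact_mod_cast hT
  have hβ0 := hβ.1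
  rcases root_cases hm hmM hT hβ h with ⟨rfl, rfl⟩ | ⟨hβ1, hρ, heq⟩
  · have hp : ∀ t : Fin 1, (fun _ => m : Fin 1 → ℝ) t ∈ Set.Icc m M := fun _ => ⟨le_rfl, hmM.le⟩
    have h1 := hc _ hp 0
    rw [← Finset.mul_sum, hσ _ hp] at h1
    exact le_of_mul_le_mul_right (by linarith) hm
  · by_contra! hlt
    set ρ := 1 - 1 / (β * T) with hρdef
    have hρ1 : ρ ≤ 1 := sub_le_self 1 (by positivity)
    have hMm : 0 < M - m := sub_pos.2 hmM
    have hβT : β * (1 - ρ) * T = 1 := by rw [hρdef]; field_simp; ring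
    let y : ℕ → ℝ := fun k => (M - m) * ρ ^ (T - k)
    have hy : ∀ k, 0 < y k := fun k => mul_pos hMm (pow_pos hρ _)
    have hyM : ∀ k, y k ≤ M - m := fun k => mul_le_of_le_one_right hMm.le (pow_le_one₀ hρ.le hρ1)
    have hgeom : ∀ k < T, y k = ρ * y (k + 1) := by
      intro k hk
      simp only [y]
      rw [show T - k = T - (k + 1) + 1 by omega]
      ring
    let path : ℕ → Fin T → ℝ := fun k t => if t.1 < k then m + y (t + 1) else m
    have hpath : ∀ k t, path k t ∈ Set.Icc m M := by
      intro k t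
      have := hy (t + 1)
      have := hyM (t + 1)
      simp only [path]
      split_ifs <;> constructor <;> linarith
    let x : ℕ → ℝ := fun k => σ ((List.ofFn (path T)).take (k + 1))
    have hx : ∑ i ∈ Finset.range T, x i = 1 := by
      rw [← Fin.sum_univ_eq_sum_range x T]; exact hσ _ (hpath T)
    have hlt' := lt_sum_of_guarantee (n := T) (y := y) (x := x) (ρ := ρ) hm hlt hT
      (fun k _ => hy k)
      (fun k hk => by rw [hgeom k hk]; exact mul_le_of_le_one_left (hy _).le hρ1) hgeom
      (by simp only [y, Nat.sub_zero]; linarith) ?_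
    · rw [hβT, hx] at hlt'
      exact lt_irrefl _ hlt'
    · intro k h1 hk
      have hck := hc _ (hpath k) ⟨k - 1, by omega⟩
      have htot := hσ _ (hpath k)
      have hlast : path k ⟨k - 1, by omega⟩ = m + y k := by
        simp only [path]
        rw [if_pos (by omega), Nat.sub_add_cancel h1]
      rw [hlast] at hck
      refine hck.trans (le_of_eq ?_)
      have hterm : ∀ t : Fin T, path k t * σ ((List.ofFn (path k)).take (t.1 + 1)) =
          m * σ ((List.ofFn (path k)).take (t.1 + 1)) +
            if t.1 < k then y (t.1 + 1) * x t.1 else 0 := by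
        intro t
        by_cases htk : t.1 < k
        · have : (List.ofFn (path k)).take (t.1 + 1) = (List.ofFn (path T)).take (t.1 + 1) := by
            refine take_ofFn_congr fun s hs => ?_
            simp only [path]
            rw [if_pos (by omega), if_pos s.2]
          simp only [if_pos htk, x, this, path]
          ring
        · simp [path, htk]
      rw [Finset.sum_congr rfl fun t _ => hterm t, Finset.sum_add_distrib, ← Finset.mul_sum, htot,
        mul_one, Fin.sum_univ_eq_sum_range (fun t => if t < k then y (t + 1) * x t else 0) T,
        ← Finset.sum_filter]
      congr 2
      ext i
      simp only [Finset.mem_filter, Finset.mem_range]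
      omega

lemma existsUnique_root {m M : ℝ} (hm : 0 < m) (hmM : m < M) {T : ℕ} (hT : 1 ≤ T) :
    ∃! β₀ : ℝ, β₀ ∈ Set.Ioc (0:ℝ) 1 ∧
      β₀ * (M - m) * (max 0 (1 - 1 / (β₀ * T))) ^ T - (1 - β₀) * m = 0 := by
  have hT0 : (0 : ℝ) < T := by exact_mod_cast hT
  have hT1 : 1 / (T : ℝ) ≤ 1 := by rw [div_le_one hT0]; exact_mod_cast hT
  have hMm : 0 < M - m := sub_pos.2 hmM
  let f : ℝ → ℝ := fun β => β * (M - m) * (max 0 (1 - 1 / (β * T))) ^ T - (1 - β) * m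
  have hmono : StrictMonoOn f (Set.Ioc 0 1) := by
    intro a ha b hb hab
    have ha0 := ha.1
    have hb0 := hb.1
    have h1 : max 0 (1 - 1 / (a * T)) ≤ max 0 (1 - 1 / (b * T)) := by gcongr
    have h2 : a * (M - m) * (max 0 (1 - 1 / (a * T))) ^ T ≤
        b * (M - m) * (max 0 (1 - 1 / (b * T))) ^ T := by gcongr
    have h3 : (1 - b) * m < (1 - a) * m := by gcongr
    simp only [f]
    linarith
  have hpos : ∀ β ∈ Set.Icc (1 / (T : ℝ)) 1, 0 < β := fun β h =>
    lt_of_lt_of_le (by positivity) h.1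
  have hcont : ContinuousOn f (Set.Icc (1 / T) 1) := by
    have hd : ContinuousOn (fun β : ℝ => 1 / (β * T)) (Set.Icc (1 / T) 1) :=
      continuousOn_const.div (by fun_prop) fun β h => (mul_pos (hpos β h) hT0).ne'
    fun_prop
  have hlow : f (1 / T) ≤ 0 := by
    have : 1 - 1 / (1 / (T : ℝ) * T) = 0 := by field_simp; simp
    simp only [f, this, max_self, zero_pow (show T ≠ 0 by omega), mul_zero, zero_sub]
    exact neg_nonpos.2 (mul_nonneg (sub_nonneg.2 hT1) hm.le)
  have hhigh : 0 ≤ f 1 := by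
    simp only [f, sub_self, zero_mul, sub_zero, one_mul]
    positivity
  obtain ⟨β, hβ, hroot⟩ := intermediate_value_Icc hT1 hcont ⟨hlow, hhigh⟩
  have hβ' : β ∈ Set.Ioc (0 : ℝ) 1 := ⟨hpos β hβ, hβ.2⟩
  exact ⟨β, ⟨hβ', hroot⟩, fun γ hγ => hmono.injOn hγ.1 hβ' (hγ.2.trans hroot.symm)⟩

end OneWayTrading

/-- There is a unique `β₀ ∈ (0, 1]` with
`β₀·(M − m)·(max(0, 1 − 1/(β₀·T)))^T − (1 − β₀)·m = 0`, and the competitive ratio of the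
one-way trading problem, `sup_x inf_p r^x(p)/r*(p)`, equals `β₀`.  A trading policy is
encoded by `σ : List ℝ → ℝ`, giving the amount sold as a function of the prices revealed
so far; it must be nonnegative and sell exactly one unit in total along every price
path. -/
theorem one_way_trading_competitive_ratio
    (m M : ℝ) (hm : 0 < m) (hmM : m < M) (T : ℕ) (hT : 1 ≤ T) :
    (∃! β₀ : ℝ, β₀ ∈ Set.Ioc (0:ℝ) 1 ∧
        β₀ * (M - m) * (max 0 (1 - 1 / (β₀ * T))) ^ T - (1 - β₀) * m = 0) ∧
    (∀ β₀ : ℝ, β₀ ∈ Set.Ioc (0:ℝ) 1 →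
      β₀ * (M - m) * (max 0 (1 - 1 / (β₀ * T))) ^ T - (1 - β₀) * m = 0 →
      sSup { v : ℝ | ∃ σ : List ℝ → ℝ,
          (∀ l : List ℝ, l.length ≤ T → (∀ y ∈ l, y ∈ Set.Icc m M) → 0 ≤ σ l) ∧
          (∀ p : Fin T → ℝ, (∀ t, p t ∈ Set.Icc m M) →
            ∑ t : Fin T, σ ((List.ofFn p).take (t.1 + 1)) = 1) ∧
          v = sInf { u : ℝ | ∃ p : Fin T → ℝ, (∀ t, p t ∈ Set.Icc m M) ∧
            u = (∑ t : Fin T, p t * σ ((List.ofFn p).take (t.1 + 1))) /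
                (⨆ t : Fin T, p t) } } = β₀) := by
  refine ⟨OneWayTrading.existsUnique_root hm hmM hT, fun β hβ hroot => ?_⟩
  have : Nonempty (Fin T) := ⟨⟨0, hT⟩⟩
  have hsup : ∀ p : Fin T → ℝ, (∀ t, p t ∈ Set.Icc m M) → ∀ s, p s ≤ ⨆ t, p t := fun p _ s =>
    le_ciSup (Set.finite_range p).bddAbove s
  have hsup0 : ∀ p : Fin T → ℝ, (∀ t, p t ∈ Set.Icc m M) → 0 < ⨆ t, p t := fun p hp =>
    hm.trans_le ((hp ⟨0, hT⟩).1.trans (hsup p hp _))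
  have hS := fun (l : List ℝ) (hl : l.length ≤ T) (hy : ∀ y ∈ l, y ∈ Set.Icc m M) =>
    OneWayTrading.threatState_snd_le_one hm hmM hT hβ hroot hl hy
  refine le_antisymm (Real.sSup_le ?_ hβ.1.le) (le_csSup_of_le ⟨β, ?_⟩
    ⟨OneWayTrading.threatPolicy β m T, fun l hl hy => OneWayTrading.threatPolicy_nonneg hS hl hy,
      fun p _ => OneWayTrading.sum_threatPolicy β m hT p, rfl⟩ ?_)
  case refine_3 =>
    refine le_csInf ⟨_, fun _ => m, fun _ => ⟨le_rfl, hmM.le⟩, rfl⟩ ?_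
    rintro u ⟨p, hp, rfl⟩
    rw [le_div_iff₀ (hsup0 p hp)]
    refine le_trans ?_ (OneWayTrading.le_revenue_threatPolicy hm.le hβ.2 hT hS hp)
    obtain ⟨s, hs⟩ := exists_eq_ciSup_of_finite (f := p)
    rw [← hs]
    exact OneWayTrading.mul_le_threatState_fst β m _ _ ((List.mem_ofFn' _ _).2 ⟨s, rfl⟩)
  all_goals
    rintro v ⟨σ, hσ0, hσ1, rfl⟩
    set c := sInf { u : ℝ | ∃ p : Fin T → ℝ, (∀ t, p t ∈ Set.Icc m M) ∧
      u = (∑ t : Fin T, p t * σ ((List.ofFn p).take (t.1 + 1))) / (⨆ t : Fin T, p t) }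
    have hc0 : 0 ≤ c := Real.sInf_nonneg <| by
      rintro u ⟨p, hp, rfl⟩
      exact OneWayTrading.revenue_ratio_nonneg hm hσ0 hp
    refine OneWayTrading.guarantee_le hm hmM hT hβ hroot hσ1 fun p hp s => ?_
    refine (mul_le_mul_of_nonneg_left (hsup p hp s) hc0).trans ?_
    rw [← le_div_iff₀ (hsup0 p hp)]
    refine csInf_le ⟨0, ?_⟩ ⟨p, hp, rfl⟩
    rintro u ⟨q, hq, rfl⟩
    exact OneWayTrading.revenue_ratio_nonneg hm hσ0 hq
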